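/- The double family indexed by pairs (j,k) with j ∈ ℤ and k ≥ |j|, with terms (−1)^{k+j}·q^{(3k²+k−j²+j)/2}·((q)_{k−j}·(q)_{k+j}·(q)_k)⁻¹, is summable in ℚ((q)) and its sum equals ((q)_∞)⁻¹; that is, Σ_{j∈ℤ} Σ_{k≥|j|} (−1)^{k+j} q^{(3k²+k−j²+j)/2} / ((q)_{k−j}(q)_{k+j}(q)_k) = 1/(q)_∞. (This is the residue theorem applied to the inverted Habiro series of the figure-eight knot 4₁, whose inverted Habiro coefficients are a_{−k−1} = 1 for all k ≥ 0, using the product form of its residues.) -/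

import Mathlib

/-!
STATEMENT 16: The double family indexed by pairs (j,k) with j ∈ ℤ and k ≥ |j|,
with terms (−1)^{k+j}·q^{(3k²+k−j²+j)/2}·((q)_{k−j}·(q)_{k+j}·(q)_k)⁻¹, is
summable in ℚ((q)) and its sum equals ((q)_∞)⁻¹; that is,
Σ_{j∈ℤ} Σ_{k≥|j|} (−1)^{k+j} q^{(3k²+k−j²+j)/2} / ((q)_{k−j}(q)_{k+j}(q)_k)
  = 1/(q)_∞.
-/

noncomputable section

/-- The Laurent series variable `q` of `ℚ((q))`. -/
def qq : LaurentSeries ℚ := HahnSeries.single 1 1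

/-- `(q)_m = ∏_{i=1}^{m}(1−qⁱ)` in `ℚ((q))`. -/
def qPoch (m : ℕ) : LaurentSeries ℚ := ∏ i ∈ Finset.range m, (1 - qq ^ (i + 1))

/-- `(q)_∞ = ∏_{i≥1}(1−qⁱ)` in `ℚ((q))`. -/
def qInf : LaurentSeries ℚ := ∏' i : ℕ, (1 - qq ^ (i + 1))

/-- The term of the double family at `(j,k)`, vanishing outside `k ≥ |j|`:
`(−1)^{k+j}·q^{(3k²+k−j²+j)/2}·((q)_{k−j}·(q)_{k+j}·(q)_k)⁻¹`. -/
def figEightTerm (j : ℤ) (k : ℕ) : LaurentSeries ℚ :=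
  if (k : ℤ) < |j| then 0
  else (-1 : LaurentSeries ℚ) ^ ((k : ℤ) + j) *
    qq ^ ((3 * (k : ℤ) ^ 2 + (k : ℤ) - j ^ 2 + j) / 2) *
    (qPoch ((k : ℤ) - j).toNat * qPoch ((k : ℤ) + j).toNat * qPoch k)⁻¹

open Filter Topology

lemma qq_ne : qq ≠ 0 := by simp [qq]

lemma v_qq_zpow (n : ℤ) : Valued.v (qq ^ n) = WithZero.exp (-n) := by
  have h : Valued.v qq = WithZero.exp (-1 : ℤ) := LaurentSeries.valuation_single_zpow ℚ 1
  rw [map_zpow₀, h, ← WithZero.exp_zsmul]; simp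

lemma v_qq_pow (n : ℕ) : Valued.v (qq ^ n) = WithZero.exp (-(n : ℤ)) := by
  rw [← v_qq_zpow, zpow_natCast]

lemma v_one_sub (n : ℕ) : Valued.v (1 - qq ^ (n + 1)) = 1 := by
  apply Valuation.map_one_sub_of_lt
  rw [v_qq_pow, ← WithZero.exp_zero, WithZero.exp_lt_exp]
  push_cast; omega

lemma v_qPoch (n : ℕ) : Valued.v (qPoch n) = 1 := by
  rw [qPoch, map_prod]
  exact Finset.prod_eq_one fun i _ => v_one_sub i

lemma qPoch_ne (n : ℕ) : qPoch n ≠ 0 := by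
  intro h
  have := v_qPoch n
  rw [h, map_zero] at this
  exact zero_ne_one this

lemma qPoch_succ (n : ℕ) : qPoch (n + 1) = qPoch n * (1 - qq ^ (n + 1)) := by
  rw [qPoch, Finset.prod_range_succ, ← qPoch]

lemma qPoch_zero : qPoch 0 = 1 := by simp [qPoch]

lemma one_sub_ne (n : ℕ) : 1 - qq ^ (n + 1) ≠ 0 := by
  intro h
  have := v_one_sub n
  rw [h, map_zero] at this
  exact zero_ne_one this

def qB (N n : ℕ) : LaurentSeries ℚ :=
  if n ≤ N then qPoch N / (qPoch n * qPoch (N - n)) else 0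

lemma qB_zero (N : ℕ) : qB N 0 = 1 := by
  simp [qB, qPoch_zero, qPoch_ne]

lemma qB_last (N : ℕ) : qB N (N + 1) = 0 := by
  simp [qB]

lemma qB_symm (N n : ℕ) (h : n ≤ N) : qB N (N - n) = qB N n := by
  rw [qB, qB, if_pos h, if_pos (Nat.sub_le _ _), Nat.sub_sub_self h, mul_comm]

lemma qB_p1 (N n : ℕ) (h : n ≤ N) :
    qB (N + 1) (n + 1) = qB N n + qq ^ (n + 1) * qB N (n + 1) := by
  obtain ⟨m, rfl⟩ := Nat.exists_eq_add_of_le h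
  have e1 : n + m + 1 - (n + 1) = m := by omega
  have e2 : n + m - n = m := by omega
  have h1 := qPoch_ne n
  have h2 := qPoch_ne m
  have h3 := one_sub_ne n
  rcases m with _ | m
  · simp [qB, qPoch_zero, qPoch_ne]
  · have e3 : n + (m + 1) - (n + 1) = m := by omega
    rw [qB, qB, qB, if_pos (by omega), if_pos (by omega), if_pos (by omega), e1, e2, e3,
      qPoch_succ (n + (m + 1)), qPoch_succ n, qPoch_succ m]
    have h4 := one_sub_ne m
    have h5 := qPoch_ne m
    field_simp
    ring

lemma qB_p2 (N n : ℕ) (h : n ≤ N) :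
    qB (N + 1) (n + 1) = qq ^ (N - n) * qB N n + qB N (n + 1) := by
  obtain ⟨m, rfl⟩ := Nat.exists_eq_add_of_le h
  have e1 : n + m + 1 - (n + 1) = m := by omega
  have e2 : n + m - n = m := by omega
  have h1 := qPoch_ne n
  have h2 := qPoch_ne m
  have h3 := one_sub_ne n
  rcases m with _ | m
  · simp [qB, qPoch_zero, qPoch_ne]
  · have e3 : n + (m + 1) - (n + 1) = m := by omega
    rw [qB, qB, qB, if_pos (by omega), if_pos (by omega), if_pos (by omega), e1, e2, e3,
      qPoch_succ (n + (m + 1)), qPoch_succ n, qPoch_succ m]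
    have h4 := one_sub_ne m
    have h5 := qPoch_ne m
    field_simp
    ring

lemma sumP1 (f : ℕ → LaurentSeries ℚ) (N : ℕ) :
    ∑ n ∈ Finset.range (N + 2), f n * qB (N + 1) n =
    ∑ n ∈ Finset.range (N + 1), f (n + 1) * qB N n +
    ∑ n ∈ Finset.range (N + 1), f n * qq ^ n * qB N n := by
  have key : ∑ n ∈ Finset.range (N + 1), f n * qq ^ n * qB N n =
      ∑ n ∈ Finset.range (N + 2), f n * qq ^ n * qB N n := by
    rw [Finset.sum_range_succ _ (N + 1), qB_last]; simp
  rw [key, Finset.sum_range_succ' _ (N + 1), Finset.sum_range_succ' _ (N + 1), ← add_assoc,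
    ← Finset.sum_add_distrib, qB_zero, qB_zero]
  congr 1
  · refine Finset.sum_congr rfl fun n hn => ?_
    rw [qB_p1 N n (by simpa [Nat.lt_succ_iff] using hn)]; ring
  · simp

lemma sumP2 (f : ℕ → LaurentSeries ℚ) (N : ℕ) :
    ∑ n ∈ Finset.range (N + 2), f n * qB (N + 1) n =
    ∑ n ∈ Finset.range (N + 1), f (n + 1) * qq ^ (N - n) * qB N n +
    ∑ n ∈ Finset.range (N + 1), f n * qB N n := by
  have key : ∑ n ∈ Finset.range (N + 1), f n * qB N n =
      ∑ n ∈ Finset.range (N + 2), f n * qB N n := by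
    rw [Finset.sum_range_succ _ (N + 1), qB_last]; simp
  rw [key, Finset.sum_range_succ' _ (N + 1), Finset.sum_range_succ' _ (N + 1), ← add_assoc,
    ← Finset.sum_add_distrib, qB_zero, qB_zero]
  congr 1
  refine Finset.sum_congr rfl fun n hn => ?_
  rw [qB_p2 N n (by simpa [Nat.lt_succ_iff] using hn)]; ring

/-- finite Durfee identity -/
lemma durfee (N : ℕ) : ∀ c : ℕ,
    ∑ k ∈ Finset.range (N + 1), (qq ^ (k ^ 2 + c * k) / qPoch (k + c)) * qB N k
      = 1 / qPoch (N + c) := by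
  induction N with
  | zero => intro c; simp [qB_zero]
  | succ N ih =>
    intro c
    rw [sumP2, ih c]
    have : ∑ n ∈ Finset.range (N + 1),
        qq ^ ((n + 1) ^ 2 + c * (n + 1)) / qPoch (n + 1 + c) * qq ^ (N - n) * qB N n
        = qq ^ (N + 1 + c) * ∑ k ∈ Finset.range (N + 1),
          (qq ^ (k ^ 2 + (c + 1) * k) / qPoch (k + (c + 1))) * qB N k := by
      rw [Finset.mul_sum]
      refine Finset.sum_congr rfl fun n hn => ?_
      have hn' : n ≤ N := by simpa [Nat.lt_succ_iff] using hn
      obtain ⟨m, rfl⟩ := Nat.exists_eq_add_of_le hn'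
      rw [show n + m - n = m by omega, show n + 1 + c = n + (c + 1) by ring]
      ring
    rw [this, ih (c + 1), show N + (c + 1) = N + c + 1 by ring,
      show N + 1 + c = N + c + 1 by ring, qPoch_succ]
    have h1 := qPoch_ne (N + c)
    have h2 := one_sub_ne (N + c)
    field_simp
    ring

def qF (N : ℕ) (a : ℤ) : LaurentSeries ℚ :=
  ∑ n ∈ Finset.range (N + 1), ((-1) ^ n * qq ^ ((n : ℤ) * a - (n.choose 2 : ℤ))) * qB N n

lemma choose_two_cast (n : ℕ) : 2 * (n.choose 2 : ℤ) = n * (n - 1) := by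
  induction n with
  | zero => simp
  | succ n ih =>
    rw [Nat.choose_succ_succ' n 1, Nat.choose_one_right]; push_cast; linarith

lemma choose_two_succ (n : ℕ) : ((n + 1).choose 2 : ℤ) = n + (n.choose 2 : ℤ) := by
  rw [Nat.choose_succ_succ' n 1, Nat.choose_one_right]; push_cast; rfl

lemma qF_p1 (N : ℕ) (a : ℤ) : qF (N + 1) a = qF N (a + 1) - qq ^ a * qF N (a - 1) := by
  rw [qF, sumP1, qF, qF, Finset.mul_sum, add_comm, sub_eq_add_neg, ← Finset.sum_neg_distrib]
  congr 1
  · refine Finset.sum_congr rfl fun n _ => ?_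
    rw [mul_assoc _ _ (qq ^ n), ← zpow_natCast qq n, ← zpow_add₀ qq_ne]
    congr 3; ring
  · refine Finset.sum_congr rfl fun n _ => ?_
    rw [choose_two_succ, show ((n + 1 : ℕ) : ℤ) * a - (n + (n.choose 2 : ℤ))
      = a + (n * (a - 1) - n.choose 2) by push_cast; ring, zpow_add₀ qq_ne a, pow_succ]
    ring

lemma qF_p2 (N : ℕ) (a : ℤ) :
    qF (N + 1) a = qF N a - qq ^ (a + N) * qF N (a - 2) := by
  rw [qF, sumP2, qF, qF, Finset.mul_sum, add_comm, sub_eq_add_neg, ← Finset.sum_neg_distrib]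
  congr 1
  refine Finset.sum_congr rfl fun n hn => ?_
  have hn' : n ≤ N := by simpa [Nat.lt_succ_iff] using hn
  rw [choose_two_succ, mul_assoc _ _ (qq ^ (N - n)), ← zpow_natCast qq (N - n),
    ← zpow_add₀ qq_ne, Nat.cast_sub hn', show ((n + 1 : ℕ) : ℤ) * a - (n + (n.choose 2 : ℤ)) + (N - n)
      = (a + N) + (n * (a - 2) - n.choose 2) by push_cast; ring, zpow_add₀ qq_ne (a + N), pow_succ]
  ring

lemma qF_symm (N : ℕ) (a : ℤ) :
    qF N a = (-1) ^ N * qq ^ (N * a - (N.choose 2 : ℤ)) * qF N (N - 1 - a) := by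
  rw [qF, ← Finset.sum_range_reflect, qF, Finset.mul_sum]
  refine Finset.sum_congr rfl fun n hn => ?_
  have hn' : n ≤ N := by simpa [Nat.lt_succ_iff] using hn
  rw [show N + 1 - 1 - n = N - n by omega, qB_symm N n hn']
  have e : ((N - n : ℕ) : ℤ) * a - ((N - n).choose 2 : ℤ) =
      (N * a - (N.choose 2 : ℤ)) + (n * (N - 1 - a) - n.choose 2) := by
    have h1 := choose_two_cast (N - n)
    have h2 := choose_two_cast N
    have h3 := choose_two_cast n
    rw [Nat.cast_sub hn'] at *
    nlinarith
  rw [e, zpow_add₀ qq_ne]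
  have s : (-1 : LaurentSeries ℚ) ^ (N - n) = (-1) ^ N * (-1) ^ n := by
    obtain ⟨m, rfl⟩ := Nat.exists_eq_add_of_le hn'
    rw [show n + m - n = m by omega, pow_add, mul_right_comm, ← mul_pow]; simp
  rw [s]; ring

lemma qF_odd (m : ℕ) : qF (2 * m + 1) m = 0 := by
  have h := qF_symm (2 * m + 1) m
  have e : ((2 * m + 1 : ℕ) : ℤ) * m - ((2 * m + 1).choose 2 : ℤ) = 0 := by
    have := choose_two_cast (2 * m + 1)
    push_cast at *; nlinarith
  rw [e, show ((2 * m + 1 : ℕ) : ℤ) - 1 - m = m by push_cast; ring, pow_succ, pow_mul] at h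
  have h2 : (2 : LaurentSeries ℚ) * qF (2 * m + 1) m = 0 := by
    simp at h; linear_combination h
  have h3 : (2 : LaurentSeries ℚ) ≠ 0 := by
    have : CharZero (LaurentSeries ℚ) :=
      charZero_of_injective_algebraMap (algebraMap ℚ (LaurentSeries ℚ)).injective
    exact two_ne_zero
  exact (mul_eq_zero.mp h2).resolve_left h3

lemma qF_even (m : ℕ) : qF (2 * m) m = qq ^ (m : ℤ) * qF (2 * m) (m - 1) := by
  have h := qF_symm (2 * m) m
  have e : ((2 * m : ℕ) : ℤ) * m - ((2 * m).choose 2 : ℤ) = m := by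
    have := choose_two_cast (2 * m)
    push_cast at *; nlinarith
  rw [e, show ((2 * m : ℕ) : ℤ) - 1 - m = m - 1 by push_cast; ring, pow_mul] at h
  simpa using h

lemma qF_main (m : ℕ) : qF (2 * m) m = qPoch (2 * m) / qPoch m := by
  induction m with
  | zero => simp [qF, qB_zero, qPoch_zero]
  | succ m ih =>
    have z := qF_odd m
    have s := qF_even m
    have z' : qF (2 * m + 1) (m : ℤ) = qF (2 * m) (m + 1) - qq ^ (m : ℤ) * qF (2 * m) (m - 1) :=
      qF_p1 (2 * m) m
    have a1 := qF_p1 (2 * m) (m + 1)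
    have a2 := qF_p2 (2 * m) (m + 1)
    have a3 := qF_p2 (2 * m) (m + 2)
    have a4 := qF_p1 (2 * m + 1) (m + 1)
    have t : (m : ℤ) + 1 + 1 = m + 2 := by ring
    have t2 : (m : ℤ) + 1 - 1 = m := by ring
    have t3 : (m : ℤ) + 1 - 2 = m - 1 := by ring
    have t4 : (m : ℤ) + 2 - 2 = m := by ring
    have t5 : (m : ℤ) + 1 + (2 * m : ℕ) = (2 * m + 1) + m := by push_cast; ring
    rw [t, t2] at a1 a4
    rw [t3, t5, zpow_add₀ qq_ne _ (m : ℤ)] at a2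
    rw [t4] at a3
    rw [show 2 * (m + 1) = 2 * m + 1 + 1 by ring, Nat.cast_succ, a4, z, a3]
    have p1 : qq ^ ((m : ℤ) + 1) = qq ^ (m + 1) := by exact_mod_cast zpow_natCast qq (m + 1)
    have p2 : qq ^ (2 * (m : ℤ) + 1) = qq ^ (2 * m + 1) := by
      exact_mod_cast zpow_natCast qq (2 * m + 1)
    have p3 : qq ^ ((m : ℤ) + 2 + (2 * m : ℕ)) = qq ^ (3 * m + 2) := by
      rw [← zpow_natCast]; congr 1; push_cast; ring
    rw [p1] at a1
    rw [p2] at a2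
    rw [p1, p3]
    have fin : qF (2 * m) (m + 2) - qq ^ (3 * m + 2) * qF (2 * m) m =
        (1 + qq ^ (m + 1)) * (1 - qq ^ (2 * m + 1)) * qF (2 * m) m := by
      linear_combination a2 - a1 - z' + z - (1 - qq ^ (2 * m + 1)) * s
    rw [mul_zero, sub_zero, fin, ih, qPoch_succ (2 * m + 1), qPoch_succ (2 * m), qPoch_succ m]
    have h1 := qPoch_ne m
    have h2 := one_sub_ne m
    field_simp
    ring

lemma ball_mem (x : LaurentSeries ℚ) (n : ℕ) :
    {y | Valued.v (y - x) ≤ WithZero.exp (-(n : ℤ))} ∈ 𝓝 x := by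
  rw [Valued.mem_nhds]
  have h : Valued.v.restrict (qq ^ n) ≠ 0 := by simp [qq_ne]
  refine ⟨Units.mk0 _ h, fun y hy => ?_⟩
  have := (Valuation.restrict_lt_iff _).mp hy
  rw [v_qq_pow] at this
  exact this.le

lemma exists_ball (x : LaurentSeries ℚ) (s : Set (LaurentSeries ℚ)) (hs : s ∈ 𝓝 x) :
    ∃ n : ℕ, {y | Valued.v (y - x) ≤ WithZero.exp (-(n : ℤ))} ⊆ s := by
  rw [Valued.mem_nhds] at hs
  obtain ⟨γ, hγ⟩ := hs
  have hz0 : MonoidWithZeroHom.ValueGroup₀.embedding γ.1 ≠ 0 :=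
    (map_ne_zero _).mpr γ.ne_zero
  refine ⟨(-(WithZero.log (MonoidWithZeroHom.ValueGroup₀.embedding γ.1)) + 1).toNat,
    fun y hy => hγ ?_⟩
  change Valued.v.restrict (y - x) < γ.1
  rw [Valuation.restrict_lt_iff_lt_embedding]
  refine lt_of_le_of_lt hy ?_
  rw [← WithZero.exp_log hz0, WithZero.exp_lt_exp, WithZero.log_exp]
  omega

instance nonarch_laurent : NonarchimedeanRing (LaurentSeries ℚ) where
  is_nonarchimedean U hU := by
    obtain ⟨n, hn⟩ := exists_ball 0 U hU
    let V : AddSubgroup (LaurentSeries ℚ) :=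
      { carrier := {y | Valued.v (y - 0) ≤ WithZero.exp (-(n : ℤ))}
        zero_mem' := by simp
        add_mem' := by
          intro a b ha hb
          simp only [sub_zero, Set.mem_ofPred_eq] at *
          exact Valuation.map_add_le _ ha hb
        neg_mem' := by
          intro a ha
          simp only [sub_zero, Set.mem_ofPred_eq, Valuation.map_neg] at *
          exact ha }
    exact ⟨⟨V, AddSubgroup.isOpen_of_mem_nhds V (ball_mem 0 n)⟩, hn⟩

lemma tendsto_of_v {ι : Type*} {l : Filter ι} {f : ι → LaurentSeries ℚ} {x : LaurentSeries ℚ}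
    (h : ∀ n : ℕ, ∀ᶠ i in l, Valued.v (f i - x) ≤ WithZero.exp (-(n : ℤ))) :
    Tendsto f l (𝓝 x) := by
  intro s hs
  obtain ⟨n, hn⟩ := exists_ball x s hs
  exact (h n).mono fun i hi => hn hi

lemma exp_le {a b : ℤ} (h : b ≤ a) : (WithZero.exp (-a) : WithZero (Multiplicative ℤ)) ≤ WithZero.exp (-b) := by
  rw [WithZero.exp_le_exp]; omega

lemma v_prod_sub_one (N : ℕ) (t : Finset ℕ) (ht : ∀ i ∈ t, N ≤ i) :
    Valued.v (∏ i ∈ t, (1 - qq ^ (i + 1)) - 1) ≤ WithZero.exp (-((N + 1 : ℕ) : ℤ)) := by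
  classical
  induction t using Finset.induction_on with
  | empty => simp
  | insert a t ha ih =>
    rw [Finset.prod_insert ha]
    have e : (1 - qq ^ (a + 1)) * ∏ i ∈ t, (1 - qq ^ (i + 1)) - 1 =
      (1 - qq ^ (a + 1)) * (∏ i ∈ t, (1 - qq ^ (i + 1)) - 1) - qq ^ (a + 1) := by ring
    rw [e]
    refine Valuation.map_sub_le _ ?_ ?_
    · rw [map_mul, v_one_sub, one_mul]
      exact ih fun i hi => ht i (Finset.mem_insert_of_mem hi)
    · rw [v_qq_pow]
      apply exp_le
      have := ht a (Finset.mem_insert_self _ _)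
      push_cast; omega

lemma qPoch_hasProd : ∃ L : LaurentSeries ℚ, L ≠ 0 ∧
    HasProd (fun i : ℕ => (1 - qq ^ (i + 1))) L := by
  have hc : CauchySeq qPoch := by
    apply NonarchimedeanAddGroup.cauchySeq_of_tendsto_sub_nhds_zero
    apply tendsto_of_v
    intro n
    filter_upwards [eventually_ge_atTop n] with N hN
    rw [qPoch_succ, sub_zero, show qPoch N * (1 - qq ^ (N + 1)) - qPoch N =
      - (qPoch N * qq ^ (N + 1)) by ring, Valuation.map_neg, map_mul, v_qPoch, one_mul, v_qq_pow]
    apply exp_le; push_cast; omega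
  obtain ⟨L, hL⟩ := cauchySeq_tendsto_of_complete hc
  refine ⟨L, ?_, ?_⟩
  · rintro rfl
    have h1 : ∀ᶠ N in atTop, Valued.v (qPoch N - 0) ≤ WithZero.exp (-((1 : ℕ) : ℤ)) :=
      hL (ball_mem 0 1)
    obtain ⟨N, hN⟩ := h1.exists
    rw [sub_zero, v_qPoch] at hN
    rw [← WithZero.exp_zero, WithZero.exp_le_exp] at hN
    norm_num at hN
  · rw [HasProd, SummationFilter.unconditional_filter]
    apply tendsto_of_v
    intro n
    have h1 : ∀ᶠ N in atTop, Valued.v (qPoch N - L) ≤ WithZero.exp (-(n : ℤ)) := hL (ball_mem L n)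
    obtain ⟨N, hN, hnN⟩ := (h1.and (eventually_ge_atTop n)).exists
    filter_upwards [eventually_ge_atTop (Finset.range N)] with s hs
    have e : ∏ i ∈ s, (1 - qq ^ (i + 1)) - L =
      qPoch N * (∏ i ∈ s \ Finset.range N, (1 - qq ^ (i + 1)) - 1) + (qPoch N - L) := by
      rw [← Finset.prod_sdiff hs, ← qPoch]; ring
    rw [e]
    refine Valuation.map_add_le _ ?_ hN
    rw [map_mul, v_qPoch, one_mul]
    refine (v_prod_sub_one N _ ?_).trans (exp_le (by push_cast; omega))
    intro i hi; simpa using (Finset.mem_sdiff.mp hi).2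

lemma qInf_ne : qInf ≠ 0 := by
  obtain ⟨L, h0, h⟩ := qPoch_hasProd
  rw [qInf, h.tprod_eq]; exact h0

lemma qPoch_tendsto : Tendsto qPoch atTop (𝓝 qInf) := by
  obtain ⟨L, h0, h⟩ := qPoch_hasProd
  rw [qInf, h.tprod_eq]
  exact h.tendsto_prod_nat

lemma v_qB (N k : ℕ) (h : k ≤ N) :
    Valued.v (qB N k - 1 / qPoch k) ≤ WithZero.exp (-((N - k + 1 : ℕ) : ℤ)) := by
  have e : qB N k - 1 / qPoch k = (qPoch k)⁻¹ *
      (∏ i ∈ Finset.Ico (N - k) N, (1 - qq ^ (i + 1)) - 1) := by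
    have h1 : qPoch N = qPoch (N - k) * ∏ i ∈ Finset.Ico (N - k) N, (1 - qq ^ (i + 1)) := by
      rw [qPoch, qPoch, Finset.prod_range_mul_prod_Ico _ (Nat.sub_le _ _)]
    rw [qB, if_pos h, h1]
    have := qPoch_ne k
    have := qPoch_ne (N - k)
    field_simp
  rw [e, map_mul, map_inv₀, v_qPoch, inv_one, one_mul]
  exact v_prod_sub_one (N - k) _ fun i hi => (Finset.mem_Ico.mp hi).1

lemma durfee_tendsto : Tendsto
    (fun N => ∑ k ∈ Finset.range N, qq ^ (k ^ 2) / (qPoch k * qPoch k)) atTop (𝓝 qInf⁻¹) := by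
  rw [← tendsto_add_atTop_iff_nat 1]
  have h1 : Tendsto (fun N => (qPoch N)⁻¹) atTop (𝓝 qInf⁻¹) := qPoch_tendsto.inv₀ qInf_ne
  have h2 : Tendsto (fun N => ∑ k ∈ Finset.range (N + 1), qq ^ (k ^ 2) / (qPoch k * qPoch k)
      - (qPoch N)⁻¹) atTop (𝓝 0) := by
    apply tendsto_of_v
    intro n
    filter_upwards [eventually_ge_atTop n] with N hN
    have d := durfee N 0
    simp only [zero_mul, add_zero] at d
    rw [sub_zero, ← one_div, ← d, ← Finset.sum_sub_distrib]
    apply Valuation.map_sum_le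
    intro k hk
    have hk' : k ≤ N := by simpa [Nat.lt_succ_iff] using hk
    have e : qq ^ (k ^ 2) / (qPoch k * qPoch k) - qq ^ (k ^ 2) / qPoch k * qB N k =
      -(qq ^ (k ^ 2) * (qPoch k)⁻¹ * (qB N k - 1 / qPoch k)) := by
      have := qPoch_ne k
      field_simp
      ring
    rw [e, Valuation.map_neg, map_mul, map_mul, map_inv₀, v_qPoch, inv_one, mul_one, v_qq_pow]
    refine (mul_le_mul_right (v_qB N k hk') _).trans ?_
    rw [← WithZero.exp_add, ← neg_add]
    apply exp_le
    push_cast [hk']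
    have : (k : ℤ) ≤ k ^ 2 := by exact_mod_cast Nat.le_self_pow two_ne_zero k
    omega
  simpa using h2.add h1

lemma v_neg_one_zpow (n : ℤ) : Valued.v ((-1 : LaurentSeries ℚ) ^ n) = 1 := by
  rw [map_zpow₀, Valuation.map_neg, map_one, one_zpow]

lemma v_term (j : ℤ) (k : ℕ) :
    Valued.v (figEightTerm j k) ≤ WithZero.exp (-(k : ℤ)) := by
  rw [figEightTerm]
  split_ifs with h
  · simp
  · rw [map_mul, map_mul, map_inv₀, map_mul, map_mul, v_qPoch, v_qPoch, v_qPoch, v_neg_one_zpow,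
      v_qq_zpow]
    simp only [mul_one, inv_one, one_mul]
    apply exp_le
    rw [Int.le_ediv_iff_mul_le (by norm_num)]
    have h' := abs_le.mp (not_lt.mp h)
    have h3 : (k : ℤ) ≤ k ^ 2 := by exact_mod_cast Nat.le_self_pow two_ne_zero k
    nlinarith [mul_nonneg (show (0 : ℤ) ≤ k + j by linarith) (show (0 : ℤ) ≤ k - j by linarith)]

lemma term_summable : Summable (fun p : ℤ × ℕ => figEightTerm p.1 p.2) := by
  apply NonarchimedeanAddGroup.summable_of_tendsto_cofinite_zero
  apply tendsto_of_v
  intro n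
  rw [Filter.eventually_cofinite]
  refine (Set.Finite.prod (Set.finite_Icc (-(n : ℤ)) n) (Set.finite_Iic n)).subset ?_
  rintro ⟨j, k⟩ hp
  simp only [sub_zero, Set.mem_ofPred_eq, not_le] at hp
  have h1 := hp.trans_le (v_term j k)
  rw [WithZero.exp_lt_exp] at h1
  have h2 : |j| ≤ k := by
    by_contra h
    rw [figEightTerm, if_pos (not_le.mp h)] at hp
    simp at hp
  have := abs_le.mp h2
  simp only [Set.mem_prod, Set.mem_Icc, Set.mem_Iic]
  omega

lemma fig_inner_sum (k : ℕ) : ∑' j : ℤ, figEightTerm j k = qq ^ (k ^ 2) / (qPoch k * qPoch k) := by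
  have inj : Function.Injective (fun n : ℕ => (n : ℤ) - k) := fun a b h => by
    simpa using h
  rw [tsum_eq_sum (s := (Finset.range (2 * k + 1)).image (fun n : ℕ => (n : ℤ) - k)),
    Finset.sum_image inj.injOn]
  · have h := qF_main k
    have e : ∑ n ∈ Finset.range (2 * k + 1), figEightTerm ((n : ℤ) - k) k =
        qq ^ (k ^ 2) / (qPoch (2 * k) * qPoch k) * qF (2 * k) k := by
      rw [qF, Finset.mul_sum]
      refine Finset.sum_congr rfl fun n hn => ?_
      have hn' : n ≤ 2 * k := by simpa [Nat.lt_succ_iff] using hn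
      rw [figEightTerm, if_neg (by rw [not_lt, abs_le]; omega), qB, if_pos hn']
      have e1 : ((k : ℤ) - (n - k)).toNat = 2 * k - n := by omega
      have e2 : ((k : ℤ) + (n - k)).toNat = n := by omega
      have e3 : (k : ℤ) + (n - k) = n := by ring
      have e4 : (3 * (k : ℤ) ^ 2 + k - (n - k) ^ 2 + (n - k)) / 2 =
          (k ^ 2 : ℕ) + (n * k - n.choose 2) := by
        have := choose_two_cast n
        apply Int.ediv_eq_of_eq_mul_left (by norm_num)
        push_cast
        linear_combination this
      rw [e1, e2, e3, e4, zpow_add₀ qq_ne, zpow_natCast, zpow_natCast]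
      have h1 := qPoch_ne (2 * k)
      have h2 := qPoch_ne k
      have h3 := qPoch_ne n
      have h4 := qPoch_ne (2 * k - n)
      field_simp
    rw [e, h]
    have h1 := qPoch_ne (2 * k)
    have h2 := qPoch_ne k
    field_simp
  · intro j hj
    rw [figEightTerm, if_pos]
    by_contra h
    have := abs_le.mp (not_lt.mp h)
    apply hj
    rw [Finset.mem_image]
    exact ⟨(j + k).toNat, by rw [Finset.mem_range]; omega, by omega⟩

theorem figure_eight_residue_theorem :
    Summable (fun p : ℤ × ℕ => figEightTerm p.1 p.2) ∧
    (∀ j : ℤ, Summable (fun k : ℕ => figEightTerm j k)) ∧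
    Summable (fun j : ℤ => ∑' k : ℕ, figEightTerm j k) ∧
    ∑' (j : ℤ) (k : ℕ), figEightTerm j k = qInf⁻¹ := by
  refine ⟨term_summable, fun j => term_summable.prod_factor j, term_summable.prod, ?_⟩
  rw [← Summable.tsum_comm (f := figEightTerm) term_summable]
  have hs : Summable (fun k : ℕ => ∑' j : ℤ, figEightTerm j k) := term_summable.prod_symm.prod
  have ht := hs.hasSum.tendsto_sum_nat
  simp only [fig_inner_sum] at ht ⊢
  exact tendsto_nhds_unique ht durfee_tendsto
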